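/- Duplication formula for the hyperbolic gamma function: for ω₊, ω₋ ∈ ℂ₊, the identity G(2z+iω) = G(z)·G(z+iω₊/2)·G(z+iω₋/2)·G(z+iω) holds for every z ∈ ℂ at which both sides are defined, where G = G(ω₊,ω₋;·) denotes the meromorphic extension of the hyperbolic gamma function and ω = (ω₊+ω₋)/2. -/

import Mathlib

open MeasureTheory Set
open scoped BigOperators Classical

noncomputable section

/-- Ruijsenaars' hyperbolic gamma function `G(ω₊,ω₋;z)`, defined by the integral
representation, valid on the strip `|Im z| < Re((ω₊+ω₋)/2)`. -/
def hypGammaInt (op om z : ℂ) : ℂ :=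
  Complex.exp (Complex.I * ∫ y in Set.Ioi (0:ℝ),
    (1/(y:ℂ)) * (Complex.sin (2*(y:ℂ)*z) /
        (2 * Complex.sinh (op*(y:ℂ)) * Complex.sinh (om*(y:ℂ)))
      - z/(op*om*(y:ℂ))))

/-- The locus `-iω - Λ` (with `ω = (ω₊+ω₋)/2`, `Λ = ℤ≥0·iω₊ + ℤ≥0·iω₋`) containing the
poles of the hyperbolic gamma function; off this set the meromorphic extension is defined. -/
def hypGammaPoles (op om : ℂ) : Set ℂ :=
  {z | ∃ m n : ℕ, z = -Complex.I*(op+om)/2 - (m:ℂ)*Complex.I*op - (n:ℂ)*Complex.I*om}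

/-- Predicate expressing that `G : ℂ → ℂ` is the meromorphic extension in `z` of
Ruijsenaars' hyperbolic gamma function with quasi-periods `ω₊ = op`, `ω₋ = om`:
it agrees with the integral representation on the strip `|Im z| < Re((ω₊+ω₋)/2)`,
satisfies both functional equations (away from the zeros of the `cosh` factor, where
the two sides have poles), and is continuous away from the pole locus. -/
structure IsHypGamma (op om : ℂ) (G : ℂ → ℂ) : Prop where
  strip : ∀ z : ℂ, |z.im| < ((op+om)/2).re → G z = hypGammaInt op om z
  funEqm : ∀ z : ℂ, Complex.cosh (Real.pi * z / op) ≠ 0 →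
    G (z + Complex.I * om/2) = 2 * Complex.cosh (Real.pi * z / op) * G (z - Complex.I * om/2)
  funEqp : ∀ z : ℂ, Complex.cosh (Real.pi * z / om) ≠ 0 →
    G (z + Complex.I * op/2) = 2 * Complex.cosh (Real.pi * z / om) * G (z - Complex.I * op/2)
  cont : ContinuousOn G (hypGammaPoles op om)ᶜ


open Asymptotics Filter Topology

/-- The integrand of the integral representation of the hyperbolic gamma function. -/
def hypGammaIntegrand (op om z : ℂ) (y : ℝ) : ℂ :=
  (1/(y:ℂ)) * (Complex.sin (2*(y:ℂ)*z) /
        (2 * Complex.sinh (op*(y:ℂ)) * Complex.sinh (om*(y:ℂ)))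
      - z/(op*om*(y:ℂ)))

lemma Complex.sin_sub_id_isBigO : (fun x : ℂ => Complex.sin x - x) =O[𝓝 0] fun x => x ^ 3 := by
  refine IsBigO.of_bound 1 ?_
  filter_upwards [Metric.closedBall_mem_nhds (0:ℂ) one_pos] with x hx
  have hx : ‖x‖ ≤ 1 := by simpa using hx
  have h := Complex.sin_bound hx
  have e : Complex.sin x - x = (Complex.sin x - (x - x ^ 3 / 6)) - x ^ 3 / 6 := by ring
  rw [e, norm_pow]
  refine (norm_sub_le _ _).trans ?_
  have h5 : ‖x‖ ^ 5 ≤ ‖x‖ ^ 3 := pow_le_pow_of_le_one (norm_nonneg _) hx (by norm_num)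
  have : 0 ≤ ‖x‖ ^ 3 := by positivity
  simp only [norm_div, norm_pow, Complex.norm_ofNat]
  linarith

lemma isBigO_sin_mul_sub (c : ℂ) :
    (fun y : ℝ => Complex.sin (c * y) - c * y) =O[𝓝 0] fun y : ℝ => y ^ 3 := by
  have hc : Tendsto (fun y : ℝ => c * (y:ℂ)) (𝓝 0) (𝓝 0) := by
    have : Continuous fun y : ℝ => c * (y:ℂ) := by fun_prop
    simpa using this.tendsto 0
  refine (Complex.sin_sub_id_isBigO.comp_tendsto hc).trans (IsBigO.of_bound (‖c‖ ^ 3) ?_)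
  exact Eventually.of_forall fun y => by simp [mul_pow]

lemma isBigO_sinh_mul_sub (c : ℂ) :
    (fun y : ℝ => Complex.sinh (c * y) - c * y) =O[𝓝 0] fun y : ℝ => y ^ 3 := by
  refine ((isBigO_sin_mul_sub (c * Complex.I)).const_mul_left (-Complex.I)).congr_left fun y => ?_
  rw [show c * Complex.I * (y:ℂ) = c * y * Complex.I by ring, Complex.sin_mul_I]
  linear_combination (-Complex.sinh (c * y) + c * y) * Complex.I_sq

lemma isBigO_sinh_mul {c : ℂ} (hc : c ≠ 0) :
    (fun y : ℝ => y) =O[𝓝 0] fun y : ℝ => Complex.sinh (c * y) := by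
  have h1 : (fun y : ℝ => y ^ 3) =o[𝓝 0] fun y : ℝ => y := by
    simpa using isLittleO_pow_pow (𝕜 := ℝ) (show 1 < 3 by norm_num)
  have h2 : (fun y : ℝ => y) =O[𝓝 0] fun y : ℝ => c * (y:ℂ) :=
    IsBigO.of_bound ‖c‖⁻¹ <| Eventually.of_forall fun y => by
      have : ‖c‖ ≠ 0 := norm_ne_zero_iff.2 hc
      simp [this]
  have h3 : (fun y : ℝ => Complex.sinh (c * y)) ~[𝓝 0] fun y : ℝ => c * (y:ℂ) :=
    ((isBigO_sinh_mul_sub c).trans_isLittleO h1).trans_isBigO h2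
  exact h2.trans h3.isBigO_symm

lemma norm_sinh_ge (w : ℂ) : Real.sinh w.re ≤ ‖Complex.sinh w‖ := by
  rw [Complex.sinh, Real.sinh_eq, norm_div, Complex.norm_ofNat]
  have := norm_sub_norm_le (Complex.exp w) (Complex.exp (-w))
  simp only [Complex.norm_exp, Complex.neg_re] at this
  linarith

lemma norm_sin_le (w : ℂ) : ‖Complex.sin w‖ ≤ Real.exp |w.im| := by
  rw [Complex.sin, norm_div, norm_mul, Complex.norm_I, mul_one, Complex.norm_ofNat]
  have := norm_sub_le (Complex.exp (-w * Complex.I)) (Complex.exp (w * Complex.I))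
  simp only [Complex.norm_exp, Complex.mul_re, Complex.neg_re, Complex.neg_im, Complex.I_re,
    Complex.I_im, mul_zero, mul_one, zero_sub, neg_neg] at this
  have h1 := Real.exp_le_exp.2 (le_abs_self w.im)
  have h2 := Real.exp_le_exp.2 (neg_le_abs w.im)
  linarith

lemma sinh_mul_ne_zero {c : ℂ} (hc : 0 < c.re) {y : ℝ} (hy : 0 < y) :
    Complex.sinh (c * y) ≠ 0 := by
  refine norm_pos_iff.1 (lt_of_lt_of_le ?_ (norm_sinh_ge _))
  simpa using mul_pos hc hy

lemma exp_isBigO_sinh_mul {c : ℂ} (hc : 0 < c.re) :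
    (fun y : ℝ => Real.exp (c.re * y)) =O[atTop] fun y : ℝ => Complex.sinh (c * y) := by
  refine IsBigO.of_bound 4 ?_
  filter_upwards [eventually_ge_atTop (c.re⁻¹)] with y hy
  have h := norm_sinh_ge (c * y)
  have h1 : 1 ≤ c.re * y := by rwa [inv_le_iff_one_le_mul₀' hc] at hy
  have h2 : Real.exp (-(c.re * y)) ≤ 1 := Real.exp_le_one_iff.2 (by linarith)
  have h3 := Real.add_one_le_exp (c.re * y)
  simp only [Complex.re_mul_ofReal, Real.sinh_eq] at h
  rw [Real.norm_eq_abs, Real.abs_exp]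
  linarith

lemma hypGammaIntegrand_isBigO_one {op om : ℂ} (hop : 0 < op.re) (hom : 0 < om.re) (z : ℂ) :
    hypGammaIntegrand op om z =O[𝓝[>] 0] fun _ => (1:ℝ) := by
  have hp : op ≠ 0 := fun h => by simp [h] at hop
  have hm : om ≠ 0 := fun h => by simp [h] at hom
  have hlin : ∀ c : ℂ, (fun y : ℝ => c * (y:ℂ)) =O[𝓝[>] 0] fun y : ℝ => y := fun c =>
    IsBigO.of_bound ‖c‖ <| Eventually.of_forall fun y => by simp
  have hcube : (fun y : ℝ => y ^ 3) =O[𝓝[>] 0] fun y : ℝ => y := by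
    have := (isLittleO_pow_pow (𝕜 := ℝ) (show 1 < 3 by norm_num)).isBigO
    simpa using this.mono nhdsWithin_le_nhds
  have hS := (isBigO_sin_mul_sub (2 * z)).mono (nhdsWithin_le_nhds (s := Ioi 0))
  have hP := (isBigO_sinh_mul_sub op).mono (nhdsWithin_le_nhds (s := Ioi 0))
  have hM := (isBigO_sinh_mul_sub om).mono (nhdsWithin_le_nhds (s := Ioi 0))
  have hN : (fun y : ℝ => (op * om * y) * (Complex.sin (2 * z * y) - 2 * z * y)
      - (2 * z) * ((Complex.sinh (op * y) - op * y) * (Complex.sinh (om * y) - om * y)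
        + (Complex.sinh (op * y) - op * y) * (om * y)
        + (op * y) * (Complex.sinh (om * y) - om * y))) =O[𝓝[>] 0] fun y : ℝ => y * y ^ 3 := by
    refine ((hlin _).mul hS).sub (IsBigO.const_mul_left ?_ _)
    refine IsBigO.add (IsBigO.add ?_ ?_) ((hlin _).mul hM)
    · exact (hP.trans hcube).mul hM
    · exact (hP.mul (hlin _)).congr_right fun y => by ring
  have hD : (fun y : ℝ => (y * y * (y * y))) =O[𝓝[>] 0] fun y : ℝ => (2 * op * om) *
      (((y:ℂ) * y) * (Complex.sinh (op * y) * Complex.sinh (om * y))) := by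
    refine IsBigO.const_mul_right (by simp [hp, hm]) (IsBigO.mul ?_ (IsBigO.mul ?_ ?_))
    · exact IsBigO.of_bound 1 <| Eventually.of_forall fun y => by simp
    · exact (isBigO_sinh_mul hp).mono nhdsWithin_le_nhds
    · exact (isBigO_sinh_mul hm).mono nhdsWithin_le_nhds
  have hpos : ∀ᶠ y : ℝ in 𝓝[>] 0, 0 < y := eventually_mem_nhdsWithin
  have hD' := hD.inv_rev (hpos.mono fun y hy h => by simp [hy.ne'] at h)
  refine (hN.mul hD').congr' ?_ ?_
  · filter_upwards [hpos] with y hy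
    have h1 := sinh_mul_ne_zero hop hy
    have h2 := sinh_mul_ne_zero hom hy
    have h3 : (y:ℂ) ≠ 0 := by exact_mod_cast hy.ne'
    rw [hypGammaIntegrand, show 2 * (y:ℂ) * z = 2 * z * y by ring]
    field_simp
    ring
  · filter_upwards [hpos] with y hy
    field_simp

lemma hypGammaIntegrand_integrableAtFilter_atTop {op om : ℂ} (hop : 0 < op.re)
    (hom : 0 < om.re) {z : ℂ} (hz : |z.im| < ((op + om) / 2).re) :
    IntegrableAtFilter (hypGammaIntegrand op om z) atTop := by
  have hmeas : ∀ f : ℝ → ℂ, Measurable f → StronglyMeasurableAtFilter f atTop volume :=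
    fun f hf => hf.aestronglyMeasurable.stronglyMeasurableAtFilter
  have hz' : 2 * |z.im| < op.re + om.re := by
    have : ((op + om) / 2).re = (op.re + om.re) / 2 := by simp
    rw [this] at hz; linarith
  have e : hypGammaIntegrand op om z = fun y : ℝ =>
      (1/(y:ℂ)) * (Complex.sin (2*(y:ℂ)*z) /
        (2 * Complex.sinh (op*(y:ℂ)) * Complex.sinh (om*(y:ℂ)))) -
      (1/(y:ℂ)) * (z/(op*om*(y:ℂ))) := funext fun y => by rw [hypGammaIntegrand]; ring
  rw [e]
  refine IntegrableAtFilter.sub ?_ ?_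
  · have hg : IntegrableAtFilter
        (fun y : ℝ => Real.exp (-(op.re + om.re - 2 * |z.im|) * y)) atTop :=
      ⟨Ioi 0, Ioi_mem_atTop 0, exp_neg_integrableOn_Ioi 0 (by linarith)⟩
    refine IsBigO.integrableAtFilter ?_ (hmeas _ (by fun_prop)) hg
    have h1 : (fun y : ℝ => 1/(y:ℂ)) =O[atTop] fun _ => (1:ℝ) := by
      refine IsBigO.of_bound 1 ?_
      filter_upwards [eventually_ge_atTop 1] with y hy
      have : |y|⁻¹ ≤ 1 := inv_le_one_of_one_le₀ (hy.trans (le_abs_self y))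
      simpa using this
    have h2 : (fun y : ℝ => Complex.sin (2*(y:ℂ)*z)) =O[atTop]
        fun y : ℝ => Real.exp (2 * |z.im| * y) := by
      refine IsBigO.of_bound 1 ?_
      filter_upwards [eventually_ge_atTop 0] with y hy
      refine (norm_sin_le _).trans (le_of_eq ?_)
      have : (2*(y:ℂ)*z).im = 2 * y * z.im := by
        rw [show 2*(y:ℂ)*z = ((2 * y : ℝ) : ℂ) * z by push_cast; ring, Complex.im_ofReal_mul]
      rw [this, abs_mul, abs_of_nonneg (by linarith : 0 ≤ 2 * y), one_mul, Real.norm_eq_abs,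
        Real.abs_exp]
      ring_nf
    have h3 := ((exp_isBigO_sinh_mul hop).mul (exp_isBigO_sinh_mul hom)).const_mul_right
      (two_ne_zero (α := ℂ))
    have h4 := h3.inv_rev (Eventually.of_forall fun y h => by simp [Real.exp_ne_zero] at h)
    refine (h1.mul (h2.mul h4)).congr (fun y => ?_) fun y => ?_
    · simp only [div_eq_mul_inv, mul_assoc]
    · rw [one_mul, ← Real.exp_add, ← Real.exp_neg, ← Real.exp_add]
      ring_nf
  · have hg : IntegrableAtFilter (fun y : ℝ => y ^ (-2 : ℝ)) atTop :=
      ⟨Ioi 1, Ioi_mem_atTop 1, integrableOn_Ioi_rpow_of_lt (by norm_num) one_pos⟩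
    refine IsBigO.integrableAtFilter ?_ (hmeas _ (by fun_prop)) hg
    refine IsBigO.of_bound ‖z / (op * om)‖ ?_
    filter_upwards [eventually_gt_atTop 0] with y hy
    rw [Real.rpow_neg hy.le, Real.rpow_two]
    refine le_of_eq ?_
    simp only [norm_mul, norm_div, norm_one, Complex.norm_real, norm_inv, norm_pow]
    field_simp

lemma hypGammaIntegrand_integrableOn {op om : ℂ} (hop : 0 < op.re) (hom : 0 < om.re) {z : ℂ}
    (hz : |z.im| < ((op + om) / 2).re) :
    IntegrableOn (hypGammaIntegrand op om z) (Ioi 0) := by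
  rw [integrableOn_Ioi_iff_integrableAtFilter_atTop_nhdsWithin]
  refine ⟨hypGammaIntegrand_integrableAtFilter_atTop hop hom hz, ?_, ?_⟩
  · refine (hypGammaIntegrand_isBigO_one hop hom z).integrableAtFilter ?_ ?_
    · have : Measurable (hypGammaIntegrand op om z) := by
        unfold hypGammaIntegrand; fun_prop
      exact this.aestronglyMeasurable.stronglyMeasurableAtFilter
    · exact ⟨Ioc 0 1, Ioc_mem_nhdsGT one_pos, integrableOn_const (by simp)⟩
  · refine ContinuousOn.locallyIntegrableOn ?_ measurableSet_Ioi
    have hp : op ≠ 0 := fun h => by simp [h] at hop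
    have hm : om ≠ 0 := fun h => by simp [h] at hom
    intro y hy
    have h1 := sinh_mul_ne_zero hop hy
    have h2 := sinh_mul_ne_zero hom hy
    have h3 : (y:ℂ) ≠ 0 := by exact_mod_cast (ne_of_gt hy : y ≠ 0)
    refine ContinuousAt.continuousWithinAt ?_
    unfold hypGammaIntegrand
    fun_prop (disch := simp [*])

lemma sum_sin_shift (θ A B : ℂ) :
    Complex.sin (θ - Complex.I * (A + B)) + Complex.sin (θ + Complex.I * (A - B)) +
      Complex.sin (θ - Complex.I * (A - B)) + Complex.sin (θ + Complex.I * (A + B)) =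
      4 * Complex.sin θ * Complex.cosh A * Complex.cosh B := by
  simp only [Complex.sin_add, Complex.sin_sub, mul_comm Complex.I, Complex.cos_mul_I,
    Complex.cosh_add, Complex.cosh_sub]
  ring

lemma hypGammaIntegrand_duplication {op om : ℂ} (hop : 0 < op.re) (hom : 0 < om.re) (z : ℂ)
    {t : ℝ} (ht : 0 < t) :
    hypGammaIntegrand op om (2*z + Complex.I*(op+om)/2) t =
      2 * (hypGammaIntegrand op om z (2 * t) +
        hypGammaIntegrand op om (z + Complex.I*op/2) (2 * t) +
        hypGammaIntegrand op om (z + Complex.I*om/2) (2 * t) +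
        hypGammaIntegrand op om (z + Complex.I*(op+om)/2) (2 * t)) := by
  have hp : op ≠ 0 := fun h => by simp [h] at hop
  have hm : om ≠ 0 := fun h => by simp [h] at hom
  have ht0 : (t:ℂ) ≠ 0 := by exact_mod_cast ht.ne'
  have hdouble : ∀ c : ℂ, Complex.sinh (c * ((2 * t : ℝ) : ℂ)) =
      2 * Complex.sinh (c * t) * Complex.cosh (c * t) := fun c => by
    rw [← Complex.sinh_two_mul]; push_cast; ring_nf
  have hP := sinh_mul_ne_zero hop (mul_pos two_pos ht)
  have hM := sinh_mul_ne_zero hom (mul_pos two_pos ht)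
  rw [hdouble] at hP hM
  have hP1 : Complex.sinh (op * t) ≠ 0 := sinh_mul_ne_zero hop ht
  have hM1 : Complex.sinh (om * t) ≠ 0 := sinh_mul_ne_zero hom ht
  have hP2 : Complex.cosh (op * t) ≠ 0 := right_ne_zero_of_mul hP
  have hM2 : Complex.cosh (om * t) ≠ 0 := right_ne_zero_of_mul hM
  have hsum := sum_sin_shift (2 * t * (2*z + Complex.I*(op+om)/2)) (op * t) (om * t)
  simp only [hypGammaIntegrand, hdouble]
  rw [show 2 * t * (2*z + Complex.I*(op+om)/2) - Complex.I * (op * t + om * t) =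
      2 * ((2 * t : ℝ) : ℂ) * z by push_cast; ring,
    show 2 * t * (2*z + Complex.I*(op+om)/2) + Complex.I * (op * t - om * t) =
      2 * ((2 * t : ℝ) : ℂ) * (z + Complex.I*op/2) by push_cast; ring,
    show 2 * t * (2*z + Complex.I*(op+om)/2) - Complex.I * (op * t - om * t) =
      2 * ((2 * t : ℝ) : ℂ) * (z + Complex.I*om/2) by push_cast; ring,
    show 2 * t * (2*z + Complex.I*(op+om)/2) + Complex.I * (op * t + om * t) =
      2 * ((2 * t : ℝ) : ℂ) * (z + Complex.I*(op+om)/2) by push_cast; ring] at hsum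
  generalize Complex.sin (2 * t * (2*z + Complex.I*(op+om)/2)) = S at *
  generalize Complex.sin (2 * ((2 * t : ℝ) : ℂ) * z) = S1 at *
  generalize Complex.sin (2 * ((2 * t : ℝ) : ℂ) * (z + Complex.I*op/2)) = S2 at *
  generalize Complex.sin (2 * ((2 * t : ℝ) : ℂ) * (z + Complex.I*om/2)) = S3 at *
  generalize Complex.sin (2 * ((2 * t : ℝ) : ℂ) * (z + Complex.I*(op+om)/2)) = S4 at *
  have hS1 : S1 = 4 * S * Complex.cosh (op * t) * Complex.cosh (om * t) - S2 - S3 - S4 := by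
    linear_combination hsum
  subst hS1
  generalize Complex.sinh (op * t) = s1 at *
  generalize Complex.sinh (om * t) = s2 at *
  generalize Complex.cosh (op * t) = c1 at *
  generalize Complex.cosh (om * t) = c2 at *
  push_cast
  field_simp
  ring

lemma hypGammaInt_duplication {op om : ℂ} (hop : 0 < op.re) (hom : 0 < om.re) {z : ℂ}
    (hz1 : -((op + om) / 2).re < z.im) (hz2 : z.im < 0) :
    hypGammaInt op om (2*z + Complex.I*(op+om)/2) =
      hypGammaInt op om z * hypGammaInt op om (z + Complex.I*op/2) *
        hypGammaInt op om (z + Complex.I*om/2) *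
        hypGammaInt op om (z + Complex.I*(op+om)/2) := by
  have key : ∀ w, |w.im| < ((op+om)/2).re →
      IntegrableOn (hypGammaIntegrand op om w) (Ioi 0) :=
    fun w hw => hypGammaIntegrand_integrableOn hop hom hw
  have hre : ((op + om) / 2).re = (op.re + om.re) / 2 := by simp
  have him : ∀ c : ℂ, (z + Complex.I * c / 2).im = z.im + c.re / 2 := fun c => by simp
  rw [hre] at hz1
  have i1 := key z (by rw [hre, abs_lt]; constructor <;> linarith)
  have i2 := key (z + Complex.I*op/2) (by rw [hre, him, abs_lt]; constructor <;> linarith)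
  have i3 := key (z + Complex.I*om/2) (by rw [hre, him, abs_lt]; constructor <;> linarith)
  have i4 := key (z + Complex.I*(op+om)/2)
    (by rw [hre, him, abs_lt, Complex.add_re]; constructor <;> linarith)
  have hint : ∀ w, hypGammaInt op om w =
      Complex.exp (Complex.I * ∫ y in Ioi (0:ℝ), hypGammaIntegrand op om w y) := fun _ => rfl
  simp only [hint, ← Complex.exp_add, ← mul_add]
  have j2 := integral_add i1 i2
  have j3 := integral_add (f := fun y => hypGammaIntegrand op om z y +
    hypGammaIntegrand op om (z + Complex.I*op/2) y) (i1.add i2) i3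
  have j4 := integral_add (f := fun y => hypGammaIntegrand op om z y +
    hypGammaIntegrand op om (z + Complex.I*op/2) y +
    hypGammaIntegrand op om (z + Complex.I*om/2) y) ((i1.add i2).add i3) i4
  rw [← j2, ← j3, ← j4, setIntegral_congr_fun measurableSet_Ioi
      (fun t ht => hypGammaIntegrand_duplication hop hom z ht)]
  rw [integral_const_mul]
  have hcv := integral_comp_mul_left_Ioi (fun y => hypGammaIntegrand op om z y +
        hypGammaIntegrand op om (z + Complex.I*op/2) y +
        hypGammaIntegrand op om (z + Complex.I*om/2) y +
        hypGammaIntegrand op om (z + Complex.I*(op+om)/2) y) 0 (two_pos (α := ℝ))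
  rw [hcv, mul_zero, Complex.real_smul, Complex.ofReal_inv, Complex.ofReal_ofNat,
    mul_inv_cancel_left₀ two_ne_zero]

/-- The half-period lattice `(i/2)(ℤω₊ + ℤω₋)`. -/
def halfPeriodLattice (op om : ℂ) : Set ℂ :=
  range fun k : ℤ × ℤ => Complex.I * (k.1 * op + k.2 * om) / 2

lemma halfPeriodLattice_countable (op om : ℂ) : (halfPeriodLattice op om).Countable :=
  countable_range _

lemma mem_halfPeriodLattice {op om z : ℂ} (m n : ℤ)
    (h : z = Complex.I * (m * op + n * om) / 2) : z ∈ halfPeriodLattice op om :=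
  ⟨(m, n), h.symm⟩

lemma add_half_period_notMem {op om z : ℂ} (hz : z ∉ halfPeriodLattice op om) :
    z + Complex.I * om / 2 ∉ halfPeriodLattice op om := by
  rintro ⟨⟨m, n⟩, h⟩
  refine hz (mem_halfPeriodLattice m (n - 1) ?_)
  push_cast
  linear_combination -h

lemma cosh_ne_zero_of_forall {x : ℂ}
    (h : ∀ k : ℤ, x ≠ Complex.I * (2 * k + 1) * Real.pi / 2) : Complex.cosh x ≠ 0 := by
  rw [← Complex.cos_mul_I, Ne, Complex.cos_eq_zero_iff]
  rintro ⟨k, hk⟩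
  refine h (-k - 1) ?_
  push_cast
  linear_combination (-Complex.I) * hk + x * Complex.I_sq

lemma cosh_pi_div_ne_zero {op w : ℂ} (hop : op ≠ 0)
    (h : ∀ k : ℤ, w ≠ Complex.I * (2 * k + 1) * op / 2) :
    Complex.cosh (Real.pi * w / op) ≠ 0 := by
  refine cosh_ne_zero_of_forall fun k hk => h k ?_
  field_simp at hk ⊢
  linear_combination hk

lemma cosh_double_shift (u : ℂ) :
    2 * Complex.cosh (2 * u + Real.pi / 2 * Complex.I) =
      (2 * Complex.cosh u) * (2 * Complex.cosh (u + Real.pi / 2 * Complex.I)) := by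
  simp only [Complex.cosh_add, Complex.cosh_mul_I, Complex.sinh_mul_I, Complex.cos_pi_div_two,
    Complex.sin_pi_div_two, Complex.sinh_two_mul]
  ring

/-- The duplication formula at a given point. -/
def Duplicates (op om : ℂ) (G : ℂ → ℂ) (z : ℂ) : Prop :=
  G (2*z + Complex.I*(op+om)/2) =
      G z * G (z + Complex.I*op/2) * G (z + Complex.I*om/2) *
        G (z + Complex.I*(op+om)/2)

lemma IsHypGamma.duplicates_add_iff {op om : ℂ} {G : ℂ → ℂ} (hG : IsHypGamma op om G)
    (hop : 0 < op.re) {z : ℂ} (hz : z ∉ halfPeriodLattice op om) :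
    Duplicates op om G (z + Complex.I * om / 2) ↔ Duplicates op om G z := by
  have hp : op ≠ 0 := fun h => by simp [h] at hop
  have c0 : Complex.cosh (Real.pi * (2 * z + Complex.I * (op + om) / 2 + Complex.I * om / 2) / op)
      ≠ 0 := cosh_pi_div_ne_zero hp fun k hk => hz <| mem_halfPeriodLattice k (-1) <| by
    push_cast; linear_combination hk / 2
  have c1 : Complex.cosh (Real.pi * (z + Complex.I * om / 2) / op) ≠ 0 :=
    cosh_pi_div_ne_zero hp fun k hk => hz <| mem_halfPeriodLattice (2 * k + 1) (-1) <| by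
      push_cast; linear_combination hk
  have c2 : Complex.cosh (Real.pi * (z + Complex.I * op / 2 + Complex.I * om / 2) / op) ≠ 0 :=
    cosh_pi_div_ne_zero hp fun k hk => hz <| mem_halfPeriodLattice (2 * k) (-1) <| by
      push_cast; linear_combination hk
  have f0 := hG.funEqm _ c0
  have f1 := hG.funEqm _ c1
  have f2 := hG.funEqm _ c2
  have hc : 2 * Complex.cosh (Real.pi * (2 * z + Complex.I * (op + om) / 2 + Complex.I * om / 2)
      / op) = (2 * Complex.cosh (Real.pi * (z + Complex.I * om / 2) / op)) *
        (2 * Complex.cosh (Real.pi * (z + Complex.I * op / 2 + Complex.I * om / 2) / op)) := by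
    have := cosh_double_shift (Real.pi * (z + Complex.I * om / 2) / op)
    rw [← show Real.pi * (2 * z + Complex.I * (op + om) / 2 + Complex.I * om / 2) / op =
        2 * (Real.pi * (z + Complex.I * om / 2) / op) + Real.pi / 2 * Complex.I by
          field_simp; ring,
      ← show Real.pi * (z + Complex.I * op / 2 + Complex.I * om / 2) / op =
        Real.pi * (z + Complex.I * om / 2) / op + Real.pi / 2 * Complex.I by
          field_simp; ring] at this
    exact this
  have hne := mul_ne_zero (two_ne_zero (α := ℂ)) c0
  simp only [add_sub_cancel_right] at f0 f1 f2
  rw [hc] at f0 hne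
  rw [Duplicates, Duplicates,
    show 2 * (z + Complex.I * om / 2) + Complex.I * (op + om) / 2 =
      2 * z + Complex.I * (op + om) / 2 + Complex.I * om / 2 + Complex.I * om / 2 by ring, f0, f1,
    show z + Complex.I * om / 2 + Complex.I * (op + om) / 2 =
      z + Complex.I * op / 2 + Complex.I * om / 2 + Complex.I * om / 2 by ring, f2,
    show z + Complex.I * om / 2 + Complex.I * op / 2 = z + Complex.I * (op + om) / 2 by ring,
    ← mul_right_inj' (b := G (2 * z + Complex.I * (op + om) / 2)) hne]
  constructor <;> intro h <;> linear_combination h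

lemma IsHypGamma.duplicates_of_strip {op om : ℂ} {G : ℂ → ℂ} (hG : IsHypGamma op om G)
    (hop : 0 < op.re) (hom : 0 < om.re) {z : ℂ}
    (hz1 : -((op + om) / 2).re < z.im) (hz2 : z.im < 0) : Duplicates op om G z := by
  have hdup := hypGammaInt_duplication hop hom hz1 hz2
  have hre : ((op + om) / 2).re = (op.re + om.re) / 2 := by simp
  have him : ∀ w c : ℂ, (w + Complex.I * c / 2).im = w.im + c.re / 2 := fun w c => by simp
  have him2 : (2 * z).im = 2 * z.im := by simp
  rw [hre] at hz1
  have hs := hG.strip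
  simp only [hre] at hs
  rw [Duplicates, hs z, hs (z + Complex.I*op/2), hs (z + Complex.I*om/2),
    hs (z + Complex.I*(op+om)/2), hs (2 * z + Complex.I*(op+om)/2)]
  · exact hdup
  all_goals
    try simp only [him, him2, Complex.add_re]
    rw [abs_lt]
    constructor <;> linarith

lemma IsHypGamma.duplicates_add_nat_iff {op om : ℂ} {G : ℂ → ℂ} (hG : IsHypGamma op om G)
    (hop : 0 < op.re) (n : ℕ) {z : ℂ} (hz : z ∉ halfPeriodLattice op om) :
    Duplicates op om G (z + n * (Complex.I * om / 2)) ↔ Duplicates op om G z := by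
  induction n generalizing z with
  | zero => simp
  | succ n ih =>
    rw [← hG.duplicates_add_iff hop hz, ← ih (add_half_period_notMem hz)]
    push_cast
    ring_nf

lemma IsHypGamma.duplicates_add_int_iff {op om : ℂ} {G : ℂ → ℂ} (hG : IsHypGamma op om G)
    (hop : 0 < op.re) (n : ℤ) {z : ℂ} (hz : z ∉ halfPeriodLattice op om) :
    Duplicates op om G (z + n * (Complex.I * om / 2)) ↔ Duplicates op om G z := by
  obtain ⟨n, rfl | rfl⟩ := n.eq_nat_or_neg
  · exact_mod_cast hG.duplicates_add_nat_iff hop n hz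
  · have hz' : z + ((-n : ℤ) : ℂ) * (Complex.I * om / 2) ∉ halfPeriodLattice op om := by
      rintro ⟨⟨k, l⟩, h⟩
      refine hz (mem_halfPeriodLattice k (l + n) ?_)
      push_cast at h ⊢
      linear_combination -h
    rw [← hG.duplicates_add_nat_iff hop n hz']
    push_cast
    ring_nf

lemma IsHypGamma.duplicates_of_notMem {op om : ℂ} {G : ℂ → ℂ} (hG : IsHypGamma op om G)
    (hop : 0 < op.re) (hom : 0 < om.re) {z : ℂ} (hz : z ∉ halfPeriodLattice op om) :
    Duplicates op om G z := by
  obtain ⟨n, ⟨hn1, hn2⟩, -⟩ := existsUnique_add_zsmul_mem_Ico (half_pos hom) z.im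
    (-((om.re / 2) + op.re / 4))
  rw [← hG.duplicates_add_int_iff hop n hz]
  have him : (z + n * (Complex.I * om / 2)).im = z.im + n * (om.re / 2) := by simp
  have hre : ((op + om) / 2).re = (op.re + om.re) / 2 := by simp
  rw [zsmul_eq_mul] at hn1 hn2
  refine hG.duplicates_of_strip hop hom ?_ ?_ <;> rw [him]
  · rw [hre]; linarith
  · linarith

lemma notMem_hypGammaPoles {op om z : ℂ} (hz : z ∉ halfPeriodLattice op om) (k l : ℤ) :
    z + Complex.I * (k * op + l * om) / 2 ∉ hypGammaPoles op om := by
  rintro ⟨m, n, h⟩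
  refine hz (mem_halfPeriodLattice (-1 - 2 * m - k) (-1 - 2 * n - l) ?_)
  push_cast
  linear_combination h

lemma two_mul_notMem_hypGammaPoles {op om z : ℂ} (hz : z ∉ halfPeriodLattice op om) :
    2 * z + Complex.I * (op + om) / 2 ∉ hypGammaPoles op om := by
  rintro ⟨m, n, h⟩
  refine hz (mem_halfPeriodLattice (-1 - m) (-1 - n) ?_)
  push_cast
  linear_combination h / 2

/-- **Duplication formula** for the hyperbolic gamma function: for `ω₊, ω₋ ∈ ℂ₊`,
`G(2z+iω) = G(z)G(z+iω₊/2)G(z+iω₋/2)G(z+iω)` for every `z` at which both sides are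
defined (i.e. no argument lies on the pole locus), where `G` is the meromorphic
extension of the hyperbolic gamma function and `ω = (ω₊+ω₋)/2`. -/
theorem hypGamma_duplication (op om : ℂ) (hop : 0 < op.re) (hom : 0 < om.re)
    (G : ℂ → ℂ) (hG : IsHypGamma op om G) (z : ℂ)
    (h0 : 2*z + Complex.I*(op+om)/2 ∉ hypGammaPoles op om)
    (h1 : z ∉ hypGammaPoles op om)
    (h2 : z + Complex.I*op/2 ∉ hypGammaPoles op om)
    (h3 : z + Complex.I*om/2 ∉ hypGammaPoles op om)
    (h4 : z + Complex.I*(op+om)/2 ∉ hypGammaPoles op om) :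
    G (2*z + Complex.I*(op+om)/2) =
      G z * G (z + Complex.I*op/2) * G (z + Complex.I*om/2) *
        G (z + Complex.I*(op+om)/2) := by
  have hdense : Dense (halfPeriodLattice op om)ᶜ :=
    (halfPeriodLattice_countable op om).dense_compl ℂ
  have : (𝓝[(halfPeriodLattice op om)ᶜ] z).NeBot := mem_closure_iff_nhdsWithin_neBot.1 (hdense z)
  have hlim : ∀ f : ℂ → ℂ, Continuous f → f z ∉ hypGammaPoles op om →
      (∀ w ∉ halfPeriodLattice op om, f w ∉ hypGammaPoles op om) →
      Tendsto (fun w => G (f w)) (𝓝[(halfPeriodLattice op om)ᶜ] z) (𝓝 (G (f z))) :=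
    fun f hf hfz hfw => (hG.cont (f z) hfz).comp hf.continuousWithinAt fun w hw => hfw w hw
  have l0 := hlim (fun w => 2*w + Complex.I*(op+om)/2) (by fun_prop) h0
    fun w hw => two_mul_notMem_hypGammaPoles hw
  have l1 := hlim (fun w => w) (by fun_prop) h1
    fun w hw => by simpa using notMem_hypGammaPoles hw 0 0
  have l2 := hlim (fun w => w + Complex.I*op/2) (by fun_prop) h2
    fun w hw => by simpa using notMem_hypGammaPoles hw 1 0
  have l3 := hlim (fun w => w + Complex.I*om/2) (by fun_prop) h3
    fun w hw => by simpa using notMem_hypGammaPoles hw 0 1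
  have l4 := hlim (fun w => w + Complex.I*(op+om)/2) (by fun_prop) h4
    fun w hw => by simpa using notMem_hypGammaPoles hw 1 1
  refine tendsto_nhds_unique_of_eventuallyEq l0 (((l1.mul l2).mul l3).mul l4) ?_
  filter_upwards [self_mem_nhdsWithin] with w hw
  exact hG.duplicates_of_notMem hop hom hw

end
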